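/- Let k be a field of characteristic p > 0, n ≥ 1, and A = k[x_1,…,x_n]. For integers r ≥ 0, 1 ≤ i ≤ n, and 1 ≤ s < p^r, the divided power operator ∂_i^[s] : A → A is A_r-linear, where A_r = k[x_1^{p^r},…,x_n^{p^r}] ⊆ A; that is, ∂_i^[s](b·a) = b·∂_i^[s](a) for all b ∈ A_r and a ∈ A. Consequently the multiplication operators x_1,…,x_n and all ∂_i^[s] with s < p^r lie in the subring End_{A_r}(A) of End_k(A). -/

import Mathlib

/-- The divided power operator `∂_i^[r]` on `k[x_1,…,x_n]`, the `k`-linear map determined on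
monomials by `∂_i^[r](x^m) = C(m_i, r) • x^(m - r·ε_i)` (zero when `m_i < r`). -/
noncomputable def dividedPower (k : Type*) [Field k] (n : ℕ) (i : Fin n) (r : ℕ) :
    Module.End k (MvPolynomial (Fin n) k) :=
  (MvPolynomial.basisMonomials (Fin n) k).constr k fun m =>
    ((m i).choose r : k) • MvPolynomial.monomial (m - Finsupp.single i r) 1

/-- The Weyl algebra `A_n(k)`, the `k`-subalgebra of `End_k(k[x_1,…,x_n])` generated by the
multiplication operators by `x_1,…,x_n` together with all divided powers `∂_i^[r]`, `r ≥ 1`. -/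
noncomputable def weylAlgebra (k : Type*) [Field k] (n : ℕ) :
    Subalgebra k (Module.End k (MvPolynomial (Fin n) k)) :=
  Algebra.adjoin k
    ((Set.range fun i : Fin n => (LinearMap.mulLeft k (MvPolynomial.X i) :
        Module.End k (MvPolynomial (Fin n) k))) ∪
      {f | ∃ (i : Fin n) (r : ℕ), 1 ≤ r ∧ f = dividedPower k n i r})

/-- A ring is left coherent if every finitely generated left ideal is finitely presented. -/
def IsLeftCoherent (R : Type*) [Ring R] : Prop :=
  ∀ I : Ideal R, I.FG → Module.FinitePresentation R I

/-- A ring is right coherent if every finitely generated right ideal is finitely presented. -/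
def IsRightCoherent (R : Type*) [Ring R] : Prop :=
  ∀ I : Ideal Rᵐᵒᵖ, I.FG → Module.FinitePresentation Rᵐᵒᵖ I

/-- The subalgebra `A_r = k[x_1^{p^r},…,x_n^{p^r}]` of `A = k[x_1,…,x_n]`. -/
noncomputable def subAr (k : Type*) [Field k] (n p r : ℕ) :
    Subalgebra k (MvPolynomial (Fin n) k) :=
  Algebra.adjoin k (Set.range fun i : Fin n => MvPolynomial.X i ^ p ^ r)

/-- The ring `D_r = End_{A_r}(A)` of `A_r`-module endomorphisms of `A`, viewed as the subring of
`End_k(A)` of endomorphisms commuting with multiplication by elements of `A_r`. -/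
noncomputable def endAr (k : Type*) [Field k] (n p r : ℕ) :
    Subring (Module.End k (MvPolynomial (Fin n) k)) :=
  Subring.centralizer
    ((fun b => (LinearMap.mulLeft k b : Module.End k (MvPolynomial (Fin n) k))) ''
      (subAr k n p r : Set (MvPolynomial (Fin n) k)))

theorem dividedPower_monomial (k : Type*) [Field k] (n : ℕ) (i : Fin n) (s : ℕ)
    (m : Fin n →₀ ℕ) :
    dividedPower k n i s (MvPolynomial.monomial m 1) =
      ((m i).choose s : k) • MvPolynomial.monomial (m - Finsupp.single i s) 1 := by
  have h := (MvPolynomial.basisMonomials (Fin n) k).constr_basis k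
    (fun m => ((m i).choose s : k) •
      (MvPolynomial.monomial (m - Finsupp.single i s) 1 : MvPolynomial (Fin n) k)) m
  rwa [MvPolynomial.coe_basisMonomials] at h

theorem cast_choose_prime_pow_add (k : Type*) [Ring k] (p : ℕ) [Fact p.Prime] [CharP k p]
    {r s : ℕ} (hs : s < p ^ r) (m : ℕ) : ((p ^ r + m).choose s : k) = (m.choose s : k) := by
  rw [Nat.add_choose_eq, Nat.cast_sum, Finset.sum_eq_single (0, s)]
  · simp
  · rintro ⟨a, b⟩ hab hne
    rw [Finset.HasAntidiagonal.mem_antidiagonal] at hab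
    have ha : a ≠ 0 := by
      rintro rfl
      exact hne (by simpa using hab)
    have hdvd : p ∣ (p ^ r).choose a :=
      (Fact.out : p.Prime).dvd_choose_pow ha (by dsimp only at hab; omega)
    rw [Nat.cast_mul, (CharP.cast_eq_zero_iff k p _).2 hdvd, zero_mul]
  · simp

theorem dividedPower_X_pow_mul (k : Type*) [Field k] (p : ℕ) [Fact p.Prime] [CharP k p]
    (n : ℕ) {r s : ℕ} (hs : s < p ^ r) (i j : Fin n) (a : MvPolynomial (Fin n) k) :
    dividedPower k n i s (MvPolynomial.X j ^ p ^ r * a) =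
      MvPolynomial.X j ^ p ^ r * dividedPower k n i s a := by
  suffices h : dividedPower k n i s ∘ₗ LinearMap.mulLeft k (MvPolynomial.X j ^ p ^ r) =
      LinearMap.mulLeft k (MvPolynomial.X j ^ p ^ r) ∘ₗ dividedPower k n i s from
    LinearMap.congr_fun h a
  refine (MvPolynomial.basisMonomials (Fin n) k).ext fun m => ?_
  simp only [MvPolynomial.coe_basisMonomials, LinearMap.comp_apply, LinearMap.mulLeft_apply,
    MvPolynomial.X_pow_eq_monomial, MvPolynomial.monomial_mul, one_mul, dividedPower_monomial,
    mul_smul_comm]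
  have hchoose : (((Finsupp.single j (p ^ r) + m) i).choose s : k) = ((m i).choose s : k) := by
    rcases eq_or_ne j i with rfl | hji
    · simpa using cast_choose_prime_pow_add k p hs (m j)
    · simp [hji.symm]
  rw [hchoose]
  rcases lt_or_ge (m i) s with hlt | hle
  · simp [Nat.choose_eq_zero_of_lt hlt]
  · rw [add_tsub_assoc_of_le (Finsupp.single_le_iff.2 hle)]

theorem dividedPower_mul_of_mem_subAr (k : Type*) [Field k] (p : ℕ) [Fact p.Prime] [CharP k p]
    (n : ℕ) {r s : ℕ} (hs : s < p ^ r) (i : Fin n) {b : MvPolynomial (Fin n) k}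
    (hb : b ∈ subAr k n p r) (a : MvPolynomial (Fin n) k) :
    dividedPower k n i s (b * a) = b * dividedPower k n i s a := by
  induction hb using Algebra.adjoin_induction generalizing a with
  | mem x hx =>
    obtain ⟨j, rfl⟩ := hx
    exact dividedPower_X_pow_mul k p n hs i j a
  | algebraMap c => rw [← Algebra.smul_def, ← Algebra.smul_def, map_smul]
  | add x y _ _ hx hy => rw [add_mul, map_add, hx, hy, add_mul]
  | mul x y _ _ hx hy => rw [mul_assoc, hx, hy, mul_assoc]

/-- For `1 ≤ s < p^r`, the divided power operator `∂_i^[s]` is `A_r`-linear, where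
`A_r = k[x_1^{p^r},…,x_n^{p^r}]`; consequently the multiplication operators `x_1,…,x_n` and
all such `∂_i^[s]` lie in the subring `End_{A_r}(A)` of `End_k(A)`. -/
theorem dividedPower_mem_endAr (k : Type*) [Field k] (p : ℕ) (hp : 0 < p) [CharP k p]
    (n : ℕ) (hn : 1 ≤ n) (r : ℕ) (i : Fin n) (s : ℕ) (hs1 : 1 ≤ s) (hs2 : s < p ^ r) :
    (∀ b ∈ subAr k n p r, ∀ a : MvPolynomial (Fin n) k,
        dividedPower k n i s (b * a) = b * dividedPower k n i s a) ∧
      dividedPower k n i s ∈ endAr k n p r ∧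
      ∀ j : Fin n, (LinearMap.mulLeft k (MvPolynomial.X j) :
        Module.End k (MvPolynomial (Fin n) k)) ∈ endAr k n p r := by
  have : Fact p.Prime := ⟨(CharP.char_is_prime_or_zero k p).resolve_right hp.ne'⟩
  have hlin : ∀ b ∈ subAr k n p r, ∀ a : MvPolynomial (Fin n) k,
      dividedPower k n i s (b * a) = b * dividedPower k n i s a :=
    fun _ hb a => dividedPower_mul_of_mem_subAr k p n hs2 i hb a
  refine ⟨hlin, ?_, fun j => ?_⟩
  · rintro _ ⟨b, hb, rfl⟩
    exact LinearMap.ext fun a => (hlin b hb a).symm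
  · rintro _ ⟨b, -, rfl⟩
    exact LinearMap.ext fun a => mul_left_comm b (MvPolynomial.X j) a
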